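/- Let X be a reflexive real Banach space, φ : X → ℝ ∪ {+∞} a proper convex lower semicontinuous function for which there exist a constant C > 0 and exponents p₁, p₂ > 0 with (1/C)(‖x‖_X^{p₁} − 1) ≤ φ(x) ≤ C(‖x‖_X^{p₂} + 1) for all x ∈ X, and let A : D(A) ⊆ X → X* be skew-adjoint modulo boundary operators (b₁,b₂) : D(b₁,b₂) ⊆ X → H₁ × H₂. Then there exists x̄ ∈ D(A) ∩ D(b₁,b₂) such that φ(x̄) + φ*(−Ax̄) + ½‖b₁(x̄)‖²_{H₁} + ½‖b₂(x̄)‖²_{H₂} = 0, and consequently −Ax̄ ∈ ∂φ(x̄) and b₂(x̄) = 0. -/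

import Mathlib

open scoped RealInnerProductSpace

noncomputable section

/-- Convexity for `EReal`-valued functions. -/
def ERealConvexOn {E : Type*} [AddCommGroup E] [Module ℝ E] (f : E → EReal) : Prop :=
  ∀ x y : E, ∀ s t : ℝ, 0 ≤ s → 0 ≤ t → s + t = 1 →
    f (s • x + t • y) ≤ (s : EReal) * f x + (t : EReal) * f y

/-- The Legendre conjugate of `φ : X → ℝ ∪ {+∞}`, as a function on `X*`. -/
def legendreConj {X : Type*} [NormedAddCommGroup X] [NormedSpace ℝ X]
    (φ : X → EReal) (q : X →L[ℝ] ℝ) : EReal :=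
  ⨆ x : X, ((q x : ℝ) : EReal) - φ x

/-- Reflexivity of a normed space. -/
def IsReflexiveSpace (X : Type*) [NormedAddCommGroup X] [NormedSpace ℝ X] : Prop :=
  ∀ F : (X →L[ℝ] ℝ) →L[ℝ] ℝ, ∃ x : X, ∀ p : X →L[ℝ] ℝ, F p = p x

/-- `A : D(A) ⊆ X → X*` is skew-adjoint modulo the boundary operators
`(b₁,b₂) : D(b₁,b₂) ⊆ X → H₁ × H₂`. -/
def SkewAdjointModBoundary {X H₁ H₂ : Type*}
    [NormedAddCommGroup X] [NormedSpace ℝ X]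
    [NormedAddCommGroup H₁] [InnerProductSpace ℝ H₁]
    [NormedAddCommGroup H₂] [InnerProductSpace ℝ H₂]
    (DA Db : Subspace ℝ X)
    (A : DA →ₗ[ℝ] (X →L[ℝ] ℝ))
    (b₁ : Db →ₗ[ℝ] H₁) (b₂ : Db →ₗ[ℝ] H₂) : Prop :=
  Dense {x : X | x ∈ DA ∧ x ∈ Db} ∧
  Dense {x : X | ∃ h : x ∈ DA ∧ x ∈ Db, b₁ ⟨x, h.2⟩ = 0 ∧ b₂ ⟨x, h.2⟩ = 0} ∧
  Dense {vw : H₁ × H₂ | ∃ (x : X) (h : x ∈ DA ∧ x ∈ Db), vw = (b₁ ⟨x, h.2⟩, b₂ ⟨x, h.2⟩)} ∧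
  (∀ y : X, (y ∈ DA ∧ y ∈ Db) ↔
    BddAbove {r : ℝ | ∃ (x : X) (h : x ∈ DA ∧ x ∈ Db), ‖x‖ < 1 ∧
      r = A ⟨x, h.1⟩ y - (‖b₁ ⟨x, h.2⟩‖ ^ 2 + ‖b₂ ⟨x, h.2⟩‖ ^ 2) / 2}) ∧
  (∀ (x y : X) (hx : x ∈ DA ∧ x ∈ Db) (hy : y ∈ DA ∧ y ∈ Db),
    A ⟨x, hx.1⟩ y = -(A ⟨y, hy.1⟩ x)
      + ⟪b₁ ⟨x, hx.2⟩, b₁ ⟨y, hy.2⟩⟫ - ⟪b₂ ⟨x, hx.2⟩, b₂ ⟨y, hy.2⟩⟫)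

/-- A convex set in `E × ℝ` missing the origin and containing a vertical half-cylinder
over a ball around `0` lies above the graph of a continuous linear functional. -/
theorem exists_clm_le_of_convex {E : Type*} [NormedAddCommGroup E] [NormedSpace ℝ E]
    {K : Set (E × ℝ)} (hK : Convex ℝ K) (h0 : (0 : E × ℝ) ∉ K) {r M : ℝ} (hr : 0 < r)
    (hball : ∀ p : E, ‖p‖ < r → ∀ s, M < s → (p, s) ∈ K) :
    ∃ F : E →L[ℝ] ℝ, ∀ p s, (p, s) ∈ K → F p ≤ s := by
  have hM : 0 ≤ M := by
    by_contra! h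
    exact h0 (hball 0 (by simpa using hr) 0 h)
  have hsub : Metric.ball (0 : E) r ×ˢ Set.Ioi M ⊆ interior K :=
    interior_maximal (fun ⟨p, s⟩ h => hball p (by simpa using h.1) s h.2)
      (Metric.isOpen_ball.prod isOpen_Ioi)
  have hmem : ((0 : E), M + 1) ∈ interior K := hsub ⟨by simpa using hr, by simp⟩
  obtain ⟨G, hG⟩ := geometric_hahn_banach_open_point hK.interior isOpen_interior
    (fun h => h0 (interior_subset h))
  have hG' : ∀ a ∈ K, G a ≤ 0 := by
    intro a ha
    have ha' : a ∈ closure (interior K) := by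
      rw [hK.closure_interior_eq_closure_of_nonempty_interior ⟨_, hmem⟩]
      exact subset_closure ha
    refine closure_minimal (fun b hb => ?_) (isClosed_le G.continuous continuous_const) ha'
    simpa using (hG b hb).le
  have hsplit : ∀ p s, G (p, s) = G (p, 0) + s * G (0, 1) := by
    intro p s
    rw [← smul_eq_mul, ← map_smul, ← map_add]
    simp
  have hc : G (0, 1) < 0 := by
    have h := hG _ hmem
    rw [hsplit, show ((0 : E), (0 : ℝ)) = 0 from rfl, map_zero, zero_add] at h
    exact (pos_iff_neg_of_mul_neg h).1 (by linarith)
  refine ⟨(-G (0, 1))⁻¹ • G.comp (ContinuousLinearMap.inl ℝ E ℝ), fun p s hps => ?_⟩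
  have h := hG' _ hps
  rw [hsplit] at h
  have : (-G (0, 1))⁻¹ * G (p, 0) ≤ s := by
    rw [inv_mul_le_iff₀ (by linarith)]
    linarith
  simpa using this

/-- A continuous convex function has a subgradient at every point. -/
theorem ConvexOn.exists_subgradient {E : Type*} [NormedAddCommGroup E] [NormedSpace ℝ E]
    {f : E → ℝ} (hf : ConvexOn ℝ Set.univ f) (hcont : Continuous f) (y : E) :
    ∃ q : E →L[ℝ] ℝ, ∀ z, f y + q (z - y) ≤ f z := by
  have hg : ConvexOn ℝ Set.univ fun p => f (y + p) - f y := by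
    refine ⟨convex_univ, fun p _ p' _ a b ha hb hab => ?_⟩
    have h := hf.2 (Set.mem_univ (y + p)) (Set.mem_univ (y + p')) ha hb hab
    have e : a • (y + p) + b • (y + p') = y + (a • p + b • p') := by
      rw [smul_add, smul_add, add_add_add_comm, ← add_smul, hab, one_smul]
    rw [e] at h
    simp only [smul_eq_mul] at h ⊢
    linear_combination h + f y * hab
  have hev : ∀ᶠ p in nhds (0 : E), f (y + p) - f y < 1 := by
    have hc : Continuous fun p => f (y + p) - f y := by fun_prop
    exact hc.continuousAt.eventually_lt continuousAt_const (by simp)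
  obtain ⟨r, hr, hball⟩ := Metric.eventually_nhds_iff.1 hev
  obtain ⟨q, hq⟩ := exists_clm_le_of_convex hg.convex_strict_epigraph (by simp) (M := 1) hr
    (fun p hp s hs => ⟨Set.mem_univ _, (hball (by simpa using hp)).trans hs⟩)
  refine ⟨q, fun z => ?_⟩
  have : q (z - y) ≤ f z - f y := le_of_forall_gt_imp_ge_of_dense fun s hs =>
    hq (z - y) s ⟨Set.mem_univ _, by simpa using hs⟩
  linarith

/-- A coercive convex function which is bounded below grows at least linearly. -/
theorem ConvexOn.exists_linear_growth {E : Type*} [NormedAddCommGroup E] [NormedSpace ℝ E]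
    {f : E → ℝ} (hf : ConvexOn ℝ Set.univ f) {m R : ℝ} (hR : 0 < R) (hm : ∀ x, m ≤ f x)
    (hcoer : ∀ x, R ≤ ‖x‖ → f 0 + 1 ≤ f x) :
    ∃ r > 0, ∃ k, ∀ x, r * ‖x‖ ≤ f x + k := by
  refine ⟨R⁻¹, by positivity, 1 - m, fun x => ?_⟩
  rw [inv_mul_le_iff₀ hR]
  rcases lt_or_ge ‖x‖ R with hx | hx
  · nlinarith [hm x]
  · have hx0 : 0 < ‖x‖ := hR.trans_le hx
    have hle : R / ‖x‖ ≤ 1 := (div_le_one hx0).2 hx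
    have h := hf.2 (Set.mem_univ x) (Set.mem_univ 0) (by positivity : 0 ≤ R / ‖x‖)
      (sub_nonneg.2 hle) (by ring)
    have h' := hcoer ((R / ‖x‖) • x) (by
      rw [norm_smul, Real.norm_of_nonneg (by positivity), div_mul_cancel₀ _ hx0.ne'])
    simp only [smul_zero, add_zero, smul_eq_mul] at h
    have h2 : 1 ≤ R / ‖x‖ * (f x - f 0) := by linarith
    rw [div_mul_eq_mul_div, le_div_iff₀ hx0] at h2
    nlinarith [hm 0]

theorem norm_combo_sq_le {E : Type*} [NormedAddCommGroup E] [NormedSpace ℝ E] (u v : E)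
    {a b : ℝ} (ha : 0 ≤ a) (hb : 0 ≤ b) (hab : a + b = 1) :
    ‖a • u + b • v‖ ^ 2 ≤ a * ‖u‖ ^ 2 + b * ‖v‖ ^ 2 :=
  (convexOn_univ_norm.pow (fun _ _ => norm_nonneg _) 2).2
    (Set.mem_univ u) (Set.mem_univ v) ha hb hab

section Skew

variable {X H₁ H₂ : Type*}
    [NormedAddCommGroup X] [NormedSpace ℝ X]
    [NormedAddCommGroup H₁] [InnerProductSpace ℝ H₁]
    [NormedAddCommGroup H₂] [InnerProductSpace ℝ H₂]

theorem dense_graph_of_dense_ker {Y Z : Type*} [NormedAddCommGroup Y] [NormedSpace ℝ Y]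
    [NormedAddCommGroup Z] [NormedSpace ℝ Z] {S : Submodule ℝ Y} (b : S →ₗ[ℝ] Z)
    (hker : Dense {x : Y | ∃ h : x ∈ S, b ⟨x, h⟩ = 0}) (hrange : Dense (Set.range b)) :
    Dense (Set.range fun x : S => ((x : Y), b x)) := by
  have h1 : ∀ (z : Y) (x : S), (z, b x) ∈ closure (Set.range fun x : S => ((x : Y), b x)) := by
    intro z x
    have h := map_mem_closure (f := fun k : Y => (k + (x : Y), b x))
      (t := Set.range fun x : S => ((x : Y), b x)) (by fun_prop) (hker (z - x)) (by
        rintro k ⟨hk, hk0⟩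
        exact ⟨⟨k, hk⟩ + x, by simp [hk0]⟩)
    simpa using h
  rintro ⟨z, w⟩
  have h := map_mem_closure (f := fun w : Z => (z, w))
    (t := closure (Set.range fun x : S => ((x : Y), b x))) (by fun_prop) (hrange w) (by
      rintro _ ⟨x, rfl⟩
      exact h1 z x)
  simpa using h

/-- Weak duality and separation yield a point of `X` dominated by the Lagrangian
`(x, q) ↦ f x + f* q + ½ (‖b₁ x‖² + ‖b₂ x‖²)`. -/
theorem exists_dual_point (hrefl : IsReflexiveSpace X) {f : X → ℝ}
    (hf : ConvexOn ℝ Set.univ f) (hgrow : ∃ r > 0, ∃ k, ∀ x, r * ‖x‖ ≤ f x + k)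
    {S : Submodule ℝ X} (A : S →ₗ[ℝ] (X →L[ℝ] ℝ)) (b₁ : S →ₗ[ℝ] H₁) (b₂ : S →ₗ[ℝ] H₂)
    (hskew : ∀ x y : S, A x y = -(A y x) + ⟪b₁ x, b₁ y⟫ - ⟪b₂ x, b₂ y⟫) :
    ∃ y : X, ∀ (x : S) (q : X →L[ℝ] ℝ) (m : ℝ), (∀ z, q z - f z ≤ m) →
      q y + A x y ≤ f x + m + (‖b₁ x‖ ^ 2 + ‖b₂ x‖ ^ 2) / 2 := by
  obtain ⟨r, hr, k, hk⟩ := hgrow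
  let K : Set ((X →L[ℝ] ℝ) × ℝ) := {ps | ∃ (x : S) (q : X →L[ℝ] ℝ) (m : ℝ),
    (∀ z, q z - f z ≤ m) ∧ ps.1 = q + A x ∧ f x + m + (‖b₁ x‖ ^ 2 + ‖b₂ x‖ ^ 2) / 2 < ps.2}
  have hK : Convex ℝ K := by
    rintro ⟨p, s⟩ ⟨x, q, m, hm, hp, hs⟩ ⟨p', s'⟩ ⟨x', q', m', hm', hp', hs'⟩ a b ha hb hab
    dsimp only at hp hp' hs hs'
    refine ⟨a • x + b • x', a • q + b • q', a * m + b * m', fun z => ?_, ?_, ?_⟩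
    · have h1 := mul_le_mul_of_nonneg_left (hm z) ha
      have h2 := mul_le_mul_of_nonneg_left (hm' z) hb
      simp only [add_apply, smul_apply, smul_eq_mul]
      linear_combination h1 + h2 + f z * hab
    · simp only [Prod.fst_add, Prod.smul_fst, hp, hp', map_add, map_smul, smul_add]
      abel
    · have h1 := hf.2 (Set.mem_univ (x : X)) (Set.mem_univ (x' : X)) ha hb hab
      have h2 := norm_combo_sq_le (b₁ x) (b₁ x') ha hb hab
      have h3 := norm_combo_sq_le (b₂ x) (b₂ x') ha hb hab
      have h4 : a * (f x + m + (‖b₁ x‖ ^ 2 + ‖b₂ x‖ ^ 2) / 2)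
          + b * (f x' + m' + (‖b₁ x'‖ ^ 2 + ‖b₂ x'‖ ^ 2) / 2) < a * s + b * s' := by
        rcases ha.eq_or_lt with rfl | ha'
        · obtain rfl : b = 1 := by linarith
          linarith
        · exact add_lt_add_of_lt_of_le (mul_lt_mul_of_pos_left hs ha')
            (mul_le_mul_of_nonneg_left hs'.le hb)
      simp only [Submodule.coe_add, Submodule.coe_smul, map_add, map_smul, Prod.snd_add,
        Prod.smul_snd, smul_eq_mul] at h1 ⊢
      linarith
  have h0 : (0 : (X →L[ℝ] ℝ) × ℝ) ∉ K := by
    rintro ⟨x, q, m, hm, hp, hs⟩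
    have h1 := hm x
    have h2 : (0 : ℝ) = q x + A x x := DFunLike.congr_fun hp (x : X)
    have h3 := hskew x x
    rw [real_inner_self_eq_norm_sq, real_inner_self_eq_norm_sq] at h3
    have h4 : f x + m + (‖b₁ x‖ ^ 2 + ‖b₂ x‖ ^ 2) / 2 < 0 := hs
    nlinarith [sq_nonneg ‖b₂ x‖]
  obtain ⟨F, hF⟩ := exists_clm_le_of_convex hK h0 (M := f 0 + k) hr fun p hp s hs => by
    refine ⟨0, p, k, fun z => ?_, by simp, by simpa using hs⟩
    have h1 : p z ≤ ‖p‖ * ‖z‖ := (le_abs_self _).trans (p.le_opNorm z)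
    have h2 : ‖p‖ * ‖z‖ ≤ r * ‖z‖ := by gcongr
    linarith [hk z]
  obtain ⟨y, hy⟩ := hrefl F
  refine ⟨y, fun x q m hm => le_of_forall_gt_imp_ge_of_dense fun s hs => ?_⟩
  have h := hF (q + A x) s ⟨x, q, m, hm, rfl, hs⟩
  rwa [hy] at h

/-- The variational principle for finite continuous `f`. -/
theorem exists_lagrangian_nonpos (hrefl : IsReflexiveSpace X) {f : X → ℝ}
    (hf : ConvexOn ℝ Set.univ f) (hcont : Continuous f)
    (hgrow : ∃ r > 0, ∃ k, ∀ x, r * ‖x‖ ≤ f x + k) {M : ℝ} (hM : ∀ x, ‖x‖ < 1 → f x ≤ M)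
    {S : Submodule ℝ X} (A : S →ₗ[ℝ] (X →L[ℝ] ℝ)) (b₁ : S →ₗ[ℝ] H₁) (b₂ : S →ₗ[ℝ] H₂)
    (hskew : ∀ x y : S, A x y = -(A y x) + ⟪b₁ x, b₁ y⟫ - ⟪b₂ x, b₂ y⟫)
    (hker : Dense {x : X | ∃ h : x ∈ S, b₁.prod b₂ ⟨x, h⟩ = 0})
    (hrange : Dense (Set.range (b₁.prod b₂)))
    (hdom : ∀ (y : X) (c : ℝ), (∀ x : S, ‖(x : X)‖ < 1 →
      A x y - (‖b₁ x‖ ^ 2 + ‖b₂ x‖ ^ 2) / 2 ≤ c) → y ∈ S) :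
    ∃ y : S, ∀ z, f y - A y z - f z + (‖b₁ y‖ ^ 2 + ‖b₂ y‖ ^ 2) / 2 ≤ 0 := by
  obtain ⟨y, hy⟩ := exists_dual_point hrefl hf hgrow A b₁ b₂ hskew
  obtain ⟨q, hq⟩ := hf.exists_subgradient hcont y
  have hle : ∀ x : S, f y + A x y ≤ f x + (‖b₁ x‖ ^ 2 + ‖b₂ x‖ ^ 2) / 2 := fun x => by
    have h := hy x q (q y - f y) fun z => by
      have := hq z
      rw [map_sub] at this
      linarith
    linarith
  have hyS : y ∈ S := hdom y (M - f y) fun x hx => by linarith [hle x, hM x hx]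
  lift y to S using hyS
  refine ⟨y, fun z => ?_⟩
  have hdense := dense_graph_of_dense_ker (b₁.prod b₂) hker hrange (z, (b₁ y, -b₂ y))
  have hclosed : IsClosed {w : X × H₁ × H₂ | f y - A y w.1 + ⟪w.2.1, b₁ y⟫ - ⟪w.2.2, b₂ y⟫
      ≤ f w.1 + (‖w.2.1‖ ^ 2 + ‖w.2.2‖ ^ 2) / 2} :=
    isClosed_le (by fun_prop) (by fun_prop)
  have h : f y - A y z + ⟪b₁ y, b₁ y⟫ - ⟪-b₂ y, b₂ y⟫
      ≤ f z + (‖b₁ y‖ ^ 2 + ‖-b₂ y‖ ^ 2) / 2 := by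
    refine closure_minimal (t := {w : X × H₁ × H₂ | _}) ?_ hclosed hdense
    rintro _ ⟨x, rfl⟩
    have h1 := hle x
    rw [hskew] at h1
    change f y - A y x + ⟪b₁ x, b₁ y⟫ - ⟪b₂ x, b₂ y⟫ ≤ f x + (‖b₁ x‖ ^ 2 + ‖b₂ x‖ ^ 2) / 2
    linarith
  rw [inner_neg_left, real_inner_self_eq_norm_sq, real_inner_self_eq_norm_sq, norm_neg] at h
  linarith

end Skew

/-- a Lax–Milgram type result for unbounded operators that are skew-adjoint
modulo boundary operators. -/
theorem stmt4 {X H₁ H₂ : Type*}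
    [NormedAddCommGroup X] [NormedSpace ℝ X] [CompleteSpace X]
    [NormedAddCommGroup H₁] [InnerProductSpace ℝ H₁] [CompleteSpace H₁]
    [NormedAddCommGroup H₂] [InnerProductSpace ℝ H₂] [CompleteSpace H₂]
    (hrefl : IsReflexiveSpace X)
    (φ : X → EReal)
    (hconv : ERealConvexOn φ)
    (hlsc : LowerSemicontinuous φ)
    (hproper : ∃ x, φ x ≠ ⊤) (hreal : ∀ x, φ x ≠ ⊥)
    (C p₁ p₂ : ℝ) (hC : 0 < C) (hp₁ : 0 < p₁) (hp₂ : 0 < p₂)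
    (hgrowth : ∀ x : X,
      (((1 / C) * (‖x‖ ^ p₁ - 1) : ℝ) : EReal) ≤ φ x ∧
        φ x ≤ ((C * (‖x‖ ^ p₂ + 1) : ℝ) : EReal))
    (DA Db : Subspace ℝ X)
    (A : DA →ₗ[ℝ] (X →L[ℝ] ℝ))
    (b₁ : Db →ₗ[ℝ] H₁) (b₂ : Db →ₗ[ℝ] H₂)
    (hA : SkewAdjointModBoundary DA Db A b₁ b₂) :
    ∃ (xbar : X) (h : xbar ∈ DA ∧ xbar ∈ Db),
      φ xbar + legendreConj φ (-(A ⟨xbar, h.1⟩))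
          + ((‖b₁ ⟨xbar, h.2⟩‖ ^ 2 / 2 + ‖b₂ ⟨xbar, h.2⟩‖ ^ 2 / 2 : ℝ) : EReal) = 0 ∧
      -- `−Ax̄ ∈ ∂φ(x̄)`
      (∀ y : X, φ xbar + (((-(A ⟨xbar, h.1⟩)) (y - xbar) : ℝ) : EReal) ≤ φ y) ∧
      b₂ ⟨xbar, h.2⟩ = 0 := by
  have hfin : ∀ x, φ x ≠ ⊤ := fun x => ne_top_of_le_ne_top (EReal.coe_ne_top _) (hgrowth x).2
  obtain ⟨f, rfl⟩ : ∃ f : X → ℝ, φ = fun x => (f x : EReal) :=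
    ⟨fun x => (φ x).toReal, funext fun x => (EReal.coe_toReal (hfin x) (hreal x)).symm⟩
  have hlow : ∀ x, 1 / C * (‖x‖ ^ p₁ - 1) ≤ f x := fun x => EReal.coe_le_coe_iff.1 (hgrowth x).1
  have hupp : ∀ x, f x ≤ C * (‖x‖ ^ p₂ + 1) := fun x => EReal.coe_le_coe_iff.1 (hgrowth x).2
  have hf : ConvexOn ℝ Set.univ f :=
    ⟨convex_univ, fun x _ y _ s t hs ht hst => by
      have h := hconv x y s t hs ht hst
      beta_reduce at h
      rw [smul_eq_mul, smul_eq_mul]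
      exact_mod_cast h⟩
  have hM : ∀ x, ‖x‖ < 1 → f x ≤ C * 2 := fun x hx => by
    have h1 : ‖x‖ ^ p₂ ≤ 1 := Real.rpow_le_one (norm_nonneg _) hx.le hp₂.le
    nlinarith [hupp x]
  have hcont : Continuous f := by
    rw [← continuousOn_univ]
    refine ((hf.continuousOn_tfae isOpen_univ Set.univ_nonempty).out 3 1).1 ?_
    refine ⟨0, Set.mem_univ _, C * 2, ?_⟩
    rw [Filter.eventually_map]
    filter_upwards [Metric.ball_mem_nhds (0 : X) one_pos] with x hx
    exact hM x (by simpa using hx)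
  have hgrow : ∃ r > 0, ∃ k, ∀ x, r * ‖x‖ ≤ f x + k := by
    set T : ℝ := max 1 (C * (f 0 + 1) + 1) with hT
    have hT0 : 0 < T := lt_max_of_lt_left one_pos
    refine hf.exists_linear_growth (m := -(1 / C)) (R := T ^ p₁⁻¹)
      (by positivity) (fun x => ?_) (fun x hx => ?_)
    · have h1 : 0 ≤ 1 / C * ‖x‖ ^ p₁ := by positivity
      linarith [hlow x]
    · have h1 : T ≤ ‖x‖ ^ p₁ := (Real.rpow_inv_le_iff_of_pos hT0.le (norm_nonneg _) hp₁).1 hx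
      have h2 : C * (f 0 + 1) + 1 ≤ T := le_max_right _ _
      refine le_trans ?_ (hlow x)
      rw [one_div, le_inv_mul_iff₀ hC]
      linarith
  obtain ⟨-, hker, hrange, hdom, hskew⟩ := hA
  let A' : ↥(DA ⊓ Db) →ₗ[ℝ] (X →L[ℝ] ℝ) := A ∘ₗ Submodule.inclusion inf_le_left
  let b₁' : ↥(DA ⊓ Db) →ₗ[ℝ] H₁ := b₁ ∘ₗ Submodule.inclusion inf_le_right
  let b₂' : ↥(DA ⊓ Db) →ₗ[ℝ] H₂ := b₂ ∘ₗ Submodule.inclusion inf_le_right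
  obtain ⟨⟨y, hyS⟩, hy⟩ := exists_lagrangian_nonpos hrefl hf hcont hgrow hM A' b₁' b₂'
    (fun x y => hskew x y x.2 y.2)
    (hker.mono (by
      rintro x ⟨h, h1, h2⟩
      exact ⟨h, Prod.ext h1 h2⟩))
    (hrange.mono (by
      rintro _ ⟨x, h, e⟩
      exact ⟨⟨x, h⟩, e.symm⟩))
    (fun y c hc => (hdom y).2 ⟨c, by
      rintro _ ⟨x, h, hx, rfl⟩
      exact hc ⟨x, h⟩ hx⟩)
  have h : y ∈ DA ∧ y ∈ Db := hyS
  replace hy : ∀ z, f y - A ⟨y, h.1⟩ z - f z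
      + (‖b₁ ⟨y, h.2⟩‖ ^ 2 + ‖b₂ ⟨y, h.2⟩‖ ^ 2) / 2 ≤ 0 := hy
  have hself := hskew y y h h
  rw [real_inner_self_eq_norm_sq, real_inner_self_eq_norm_sq] at hself
  have hb₂ : b₂ ⟨y, h.2⟩ = 0 := by
    rw [← norm_eq_zero, ← sq_eq_zero_iff]
    nlinarith [hy y, sq_nonneg ‖b₂ ⟨y, h.2⟩‖]
  refine ⟨y, h, ?_, fun z => ?_, hb₂⟩
  · have hconj : legendreConj (fun x => (f x : EReal)) (-(A ⟨y, h.1⟩))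
        = ((-f y - (‖b₁ ⟨y, h.2⟩‖ ^ 2 / 2 + ‖b₂ ⟨y, h.2⟩‖ ^ 2 / 2) : ℝ) : EReal) := by
      refine le_antisymm (iSup_le fun z => ?_) (le_iSup_of_le y ?_)
      · rw [← EReal.coe_sub, EReal.coe_le_coe_iff, neg_apply]
        linarith [hy z]
      · rw [← EReal.coe_sub, EReal.coe_le_coe_iff, neg_apply]
        nlinarith [sq_nonneg ‖b₂ ⟨y, h.2⟩‖]
    rw [hconj, ← EReal.coe_add, ← EReal.coe_add, ← EReal.coe_zero]
    congr 1
    ring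
  · rw [← EReal.coe_add, EReal.coe_le_coe_iff, neg_apply, map_sub]
    have h2 := hy z
    rw [hb₂, norm_zero] at h2 hself
    linarith
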